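/- arXiv:2401.06623 — 2 statements merged into one kernel-verified Lean document; each statement's English description precedes it below -/
import Mathlib

section
/- Let n ≥ 2 and let ρ be a positive function on ℝ₊^{n+1} which extends to a C² function on the closed half-space {(x,y) : y ≥ 0}, with the following properties: (1) ρ(x,0) = 0 and ∂_y ρ(x,0) = lim_{y→0⁺} ρ(x,y)/y = 1 for every x ∈ ℝⁿ; (2) Δ log(ρ/y) + ((n−1)/2)·|∇ log(ρ/y)|² ≤ 0 on ℝ₊^{n+1} (this is equivalent to the nonnegativity of the scalar curvature R* of the compactified metric g* := ρ² y^{−2}|dz|²); (3) y|∇ρ| ≤ ρ on ℝ₊^{n+1} (i.e. |∇*ρ|_{g*} ≤ 1). Then ρ(x,y) = y for all (x,y) ∈ ℝ₊^{n+1}, i.e. g* is the Euclidean metric. -/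
open MeasureTheory Filter Set Topology
open scoped ENNReal NNReal

noncomputable section

/-- The Euclidean space `ℝ^{n+1}`. -/
abbrev E (n : ℕ) := EuclideanSpace ℝ (Fin (n + 1))

/-- The last coordinate `y` of a point `z = (x, y) ∈ ℝ^{n+1}`. -/
def ycoord {n : ℕ} (z : E n) : ℝ := z (Fin.last n)

/-- The open upper half-space `ℝ₊^{n+1}`. -/
def upperHalf (n : ℕ) : Set (E n) := {z | 0 < ycoord z}

/-- The open upper half-ball `B_r⁺`. -/
def Bplus (n : ℕ) (r : ℝ) : Set (E n) := {z | 0 < ycoord z ∧ ‖z‖ < r}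

/-- The upper hemisphere `(∂B_r)⁺`. -/
def sphPlus (n : ℕ) (r : ℝ) : Set (E n) := {z | 0 < ycoord z ∧ ‖z‖ = r}

/-- The point `(x, y) ∈ ℝ^{n+1}` built from `x ∈ ℝⁿ` and `y ∈ ℝ`. -/
def pt {n : ℕ} (x : EuclideanSpace ℝ (Fin n)) (y : ℝ) : E n :=
  (EuclideanSpace.equiv (Fin (n + 1)) ℝ).symm (Fin.snoc (fun i => x i) y)

/-- The unit vector `e_{n+1}` in the `y`-direction. -/
def eY (n : ℕ) : E n := EuclideanSpace.single (Fin.last n) (1 : ℝ)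

/-- The partial derivative `∂_y u` in the `y`-direction. -/
def partialY {n : ℕ} (u : E n → ℝ) (z : E n) : ℝ := fderiv ℝ u z (eY n)

/-- The Euclidean Laplacian `Δu = ∑ ∂²u/∂z_i²`. -/
def lap {n : ℕ} (u : E n → ℝ) (z : E n) : ℝ :=
  ∑ i : Fin (n + 1),
    fderiv ℝ (fun w => fderiv ℝ u w (EuclideanSpace.single i (1 : ℝ))) z
      (EuclideanSpace.single i (1 : ℝ))

/-- A C¹ function with compact support contained in `{z : ‖z‖ ≤ r, y > 0}`. -/
def IsTestFn (n : ℕ) (r : ℝ) (φ : E n → ℝ) : Prop :=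
  ContDiff ℝ 1 φ ∧ tsupport φ ⊆ {z : E n | ‖z‖ ≤ r ∧ 0 < ycoord z}

/-- The `y^a`-weighted Sobolev energy `∫_{B_r⁺} (|∇u|² + u²) y^a dz`. -/
def wInt (n : ℕ) (a : ℝ) (u : E n → ℝ) (r : ℝ) : ℝ≥0∞ :=
  ∫⁻ z in Bplus n r, ENNReal.ofReal ((‖gradient u z‖ ^ 2 + (u z) ^ 2) * (ycoord z) ^ a)

/-- Membership in `H^{1,a}(ℝ₊^{n+1})`: locally finite weighted Sobolev norm. -/
def memH1 (n : ℕ) (a : ℝ) (u : E n → ℝ) : Prop := ∀ r > 0, wInt n a u r < ⊤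

/-- Membership in `H̃^{1,a}(ℝ₊^{n+1})`: finite local weighted norm together with
approximability by C¹ functions compactly supported away from the boundary. -/
def memH1T (n : ℕ) (a : ℝ) (u : E n → ℝ) : Prop :=
  memH1 n a u ∧ ∀ r > 0, ∃ φ : ℕ → E n → ℝ, (∀ k, IsTestFn n r (φ k)) ∧
    Tendsto (fun k => wInt n a (fun z => u z - φ k z) r) atTop (nhds 0)


lemma ycoord_add_smul {n : ℕ} (z v : E n) (t : ℝ) :
    ycoord (z + t • v) = ycoord z + t * ycoord v := by
  simp [ycoord]

lemma ycoord_eY {n : ℕ} : ycoord (eY n) = 1 := by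
  simp [ycoord, eY]

lemma continuous_ycoord {n : ℕ} : Continuous (ycoord : E n → ℝ) := by
  unfold ycoord
  fun_prop

lemma isOpen_upperHalf {n : ℕ} : IsOpen (upperHalf n) :=
  isOpen_lt continuous_const continuous_ycoord

/-- Projection of a point of `ℝ^{n+1}` to `ℝⁿ`. -/
def xpart {n : ℕ} (z : E n) : EuclideanSpace ℝ (Fin n) :=
  WithLp.toLp 2 (fun i => z i.castSucc)

lemma pt_xpart {n : ℕ} (z : E n) (y : ℝ) :
    pt (xpart z) y = z + (y - ycoord z) • eY n := by
  ext i
  refine Fin.lastCases ?_ (fun j => ?_) i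
  · simp [pt, ycoord, eY]
  · have : j.castSucc ≠ Fin.last n := (Fin.castSucc_lt_last j).ne
    simp [pt, xpart, eY, this]

lemma gradient_apply_coord {n : ℕ} (u : E n → ℝ) (z : E n) (i : Fin (n + 1)) :
    gradient u z i = fderiv ℝ u z (EuclideanSpace.single i (1 : ℝ)) := by
  have h : inner ℝ (gradient u z) (EuclideanSpace.single i (1 : ℝ))
      = fderiv ℝ u z (EuclideanSpace.single i (1 : ℝ)) := by
    simp [gradient]
  rw [← h, EuclideanSpace.inner_single_right]
  simp

lemma norm_gradient_sq {n : ℕ} (u : E n → ℝ) (z : E n) :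
    ‖gradient u z‖ ^ 2 = ∑ i, (fderiv ℝ u z (EuclideanSpace.single i (1 : ℝ))) ^ 2 := by
  rw [EuclideanSpace.norm_sq_eq]
  refine Finset.sum_congr rfl fun i _ => ?_
  rw [gradient_apply_coord, Real.norm_eq_abs, sq_abs]

/-- Necessary second order condition at a local minimum. -/
lemma second_deriv_nonneg {g g' : ℝ → ℝ} {b : ℝ}
    (hg : ∀ᶠ t in 𝓝 (0 : ℝ), HasDerivAt g (g' t) t) (hg' : HasDerivAt g' b 0)
    (hmin : IsLocalMin g 0) : 0 ≤ b := by
  by_contra hb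
  push Not at hb
  have h0 : g' 0 = 0 := hmin.hasDerivAt_eq_zero hg.self_of_nhds
  -- perturbation
  set f : ℝ → ℝ := fun t => g t + (-b / 4) * t ^ 2 with hf
  have hfd : ∀ᶠ t in 𝓝 (0 : ℝ), HasDerivAt f (g' t + (-b / 2) * t) t := by
    filter_upwards [hg] with t ht
    have := ht.add ((hasDerivAt_pow 2 t).const_mul (-b / 4))
    refine this.congr_deriv ?_
    push_cast; ring
  have hd : deriv f =ᶠ[𝓝 0] fun t => g' t + (-b / 2) * t := hfd.mono fun t ht => ht.deriv
  have hdd : deriv (deriv f) 0 = b / 2 := by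
    rw [hd.deriv_eq]
    have := hg'.add ((hasDerivAt_id (0 : ℝ)).const_mul (-b / 2))
    exact (this.deriv.trans (by ring) : deriv (fun t => g' t + (-b / 2) * t) 0 = b / 2)
  have hmax : IsLocalMax f 0 := by
    apply isLocalMax_of_deriv_deriv_neg
    · rw [hdd]; linarith
    · rw [hd.self_of_nhds]; simp [h0]
    · exact hfd.self_of_nhds.continuousAt
  have hne : ∀ᶠ t in 𝓝 (0 : ℝ), t = 0 := by
    filter_upwards [hmax, hmin] with t h1 h2
    simp only [hf] at h1
    have : (-b / 4) * t ^ 2 ≤ 0 := by nlinarith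
    have h3 : t ^ 2 ≤ 0 := by
      by_contra h; push Not at h
      have : 0 < (-b / 4) * t ^ 2 := mul_pos (by linarith) h
      linarith
    exact pow_eq_zero_iff (two_ne_zero) |>.1 (le_antisymm h3 (sq_nonneg t))
  obtain ⟨ε, hε, h⟩ := Metric.eventually_nhds_iff.1 hne
  have := h (y := ε / 2) (by simp [abs_of_pos hε]; linarith)
  linarith

/-- Line version of the second order condition for `exp (c u) + quadratic`. -/
lemma line_second {n : ℕ} {u : E n → ℝ} {z : E n} (hu : ContDiffAt ℝ 2 u z) (c : ℝ) (e : E n)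
    (F : E n → ℝ) (hF : IsLocalMin F z) (A B C : ℝ)
    (hline : ∀ᶠ t in 𝓝 (0 : ℝ),
      F (z + t • e) = Real.exp (c * u (z + t • e)) + (A + B * t + C * t ^ 2)) :
    0 ≤ Real.exp (c * u z) * (c * fderiv ℝ (fun w => fderiv ℝ u w e) z e
      + c ^ 2 * (fderiv ℝ u z e) ^ 2) + 2 * C := by
  have hl : ∀ t : ℝ, HasDerivAt (fun t : ℝ => z + t • e) e t := fun t => by
    simpa using ((hasDerivAt_id t).smul_const e).const_add z
  have hcont : Tendsto (fun t : ℝ => z + t • e) (𝓝 0) (𝓝 z) := by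
    have := (hl 0).continuousAt.tendsto
    simpa using this
  have hdu : ∀ᶠ w in 𝓝 z, DifferentiableAt ℝ u w := by
    filter_upwards [hu.eventually (by simp)] with w hw
    exact hw.differentiableAt (by norm_num)
  have hd1 : ∀ᶠ t in 𝓝 (0 : ℝ),
      HasDerivAt (fun t : ℝ => u (z + t • e)) (fderiv ℝ u (z + t • e) e) t := by
    filter_upwards [hcont.eventually hdu] with t ht
    exact ht.hasFDerivAt.comp_hasDerivAt t (hl t)
  have hfd : DifferentiableAt ℝ (fun w => fderiv ℝ u w e) z := by
    have h1 : ContDiffAt ℝ 1 (fderiv ℝ u) z := hu.fderiv_right (by norm_num)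
    exact (h1.differentiableAt (by norm_num)).clm_apply (differentiableAt_const _)
  have hd2 : HasDerivAt (fun t : ℝ => fderiv ℝ u (z + t • e) e)
      (fderiv ℝ (fun w => fderiv ℝ u w e) z e) 0 := by
    have h0 : HasFDerivAt (fun w => fderiv ℝ u w e)
      (fderiv ℝ (fun w => fderiv ℝ u w e) z) (z + (0 : ℝ) • e) := by
      simpa using hfd.hasFDerivAt
    exact h0.comp_hasDerivAt (0 : ℝ) (hl 0)
  have hmin : IsLocalMin (fun t : ℝ =>
      Real.exp (c * u (z + t • e)) + (A + B * t + C * t ^ 2)) 0 := by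
    have h0 := hline.self_of_nhds
    filter_upwards [hcont.eventually hF, hline] with t ht h1
    rw [← h1, ← h0]
    simpa using ht
  have hq : ∀ t : ℝ, HasDerivAt (fun t : ℝ => A + B * t + C * t ^ 2) (B + 2 * C * t) t := by
    intro t
    have := (((hasDerivAt_id t).const_mul B).const_add A).add ((hasDerivAt_pow 2 t).const_mul C)
    refine this.congr_deriv ?_
    push_cast; ring
  have hq' : HasDerivAt (fun t : ℝ => B + 2 * C * t) (2 * C) 0 := by
    simpa using ((hasDerivAt_id (0 : ℝ)).const_mul (2 * C)).const_add B
  refine second_deriv_nonneg (g' := fun t =>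
    Real.exp (c * u (z + t • e)) * (c * fderiv ℝ u (z + t • e) e) + (B + 2 * C * t)) ?_ ?_ hmin
  · filter_upwards [hd1] with t ht
    exact (ht.const_mul c).exp.add (hq t)
  · have h1 := hd1.self_of_nhds
    have := ((h1.const_mul c).exp.mul (hd2.const_mul c)).add hq'
    refine this.congr_deriv ?_
    simp only [zero_smul, add_zero]
    ring

/-- The comparison function. -/
def barrier (n : ℕ) (R : ℝ) (z : E n) : ℝ :=
  (‖z‖ ^ 2 - ycoord z ^ 2 + (n + 1) * (ycoord z * (R - ycoord z))) / R ^ 2 + ycoord z / R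

lemma continuous_barrier (n : ℕ) (R : ℝ) : Continuous (barrier n R) := by
  have := continuous_ycoord (n := n)
  unfold barrier
  fun_prop

lemma sq_ycoord_le {n : ℕ} (z : E n) : ycoord z ^ 2 ≤ ‖z‖ ^ 2 := by
  have := PiLp.norm_apply_le z (Fin.last n)
  rw [Real.norm_eq_abs] at this
  rw [← sq_abs]
  unfold ycoord
  gcongr

lemma barrier_line {n : ℕ} (R : ℝ) (z : E n) (i : Fin (n + 1)) :
    ∃ A B : ℝ, ∀ t : ℝ, barrier n R (z + t • EuclideanSpace.single i (1 : ℝ)) =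
      A + B * t + (1 - (n + 2) * (if i = Fin.last n then 1 else 0)) / R ^ 2 * t ^ 2 := by
  set d : ℝ := if i = Fin.last n then 1 else 0 with hd
  have hdd : d ^ 2 = d := by rw [hd]; split_ifs <;> simp
  have hy : ycoord (EuclideanSpace.single i (1 : ℝ) : E n) = d := by
    simp [ycoord, hd, Pi.single_apply, eq_comm]
  refine ⟨barrier n R z,
    (2 * z i - 2 * ycoord z * d + (n + 1) * (d * R - 2 * ycoord z * d)) / R ^ 2 + d / R, ?_⟩
  intro t
  have hn : ‖z + t • (EuclideanSpace.single i (1 : ℝ) : E n)‖ ^ 2 = ‖z‖ ^ 2 + 2 * t * z i + t ^ 2 := by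
    rw [norm_add_sq_real, inner_smul_right, norm_smul]
    simp [EuclideanSpace.inner_single_right]
    ring
  unfold barrier
  rw [hn, ycoord_add_smul, hy]
  linear_combination (-(n + 2) * t ^ 2 / R ^ 2) * hdd

/-- The strict maximum principle: no interior local minimum. -/
lemma no_local_min {n : ℕ} (hn : 2 ≤ n) {u : E n → ℝ} {z : E n} (hu : ContDiffAt ℝ 2 u z)
    (hs : lap u z + (((n : ℝ) - 1) / 2) * ‖gradient u z‖ ^ 2 ≤ 0)
    {R : ℝ} (hR : 0 < R) (F : E n → ℝ) (hF : IsLocalMin F z)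
    (hFe : ∀ᶠ w in 𝓝 z, F w = Real.exp ((((n : ℝ) - 1) / 2) * u w) + barrier n R w) : False := by
  set c : ℝ := ((n : ℝ) - 1) / 2 with hc
  have hcpos : 0 < c := by
    have : (2 : ℝ) ≤ n := by exact_mod_cast hn
    rw [hc]; linarith
  have key : ∀ i : Fin (n + 1), 0 ≤ Real.exp (c * u z) *
      (c * fderiv ℝ (fun w => fderiv ℝ u w (EuclideanSpace.single i (1 : ℝ))) z
        (EuclideanSpace.single i (1 : ℝ))
      + c ^ 2 * (fderiv ℝ u z (EuclideanSpace.single i (1 : ℝ))) ^ 2)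
      + 2 * ((1 - (n + 2) * (if i = Fin.last n then 1 else 0)) / R ^ 2) := by
    intro i
    obtain ⟨A, B, hAB⟩ := barrier_line R z i
    refine line_second hu c _ F hF A B _ ?_
    have hcont : Tendsto (fun t : ℝ => z + t • (EuclideanSpace.single i (1 : ℝ) : E n))
        (𝓝 0) (𝓝 z) := by
      have : Continuous (fun t : ℝ => z + t • (EuclideanSpace.single i (1 : ℝ) : E n)) := by
        fun_prop
      simpa using this.tendsto 0
    filter_upwards [hcont.eventually hFe] with t ht
    rw [ht, hAB]
  have hsum := Finset.sum_nonneg (s := Finset.univ) fun i _ => key i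
  rw [Finset.sum_add_distrib, ← Finset.mul_sum, Finset.sum_add_distrib, ← Finset.mul_sum,
    ← Finset.mul_sum, ← Finset.mul_sum, ← norm_gradient_sq, ← Finset.sum_div,
    Finset.sum_sub_distrib, ← Finset.mul_sum] at hsum
  simp only [Finset.sum_ite_eq', Finset.mem_univ, if_true, Finset.sum_const, Finset.card_univ,
    Fintype.card_fin, nsmul_eq_mul] at hsum
  change 0 ≤ Real.exp (c * u z) * (c * lap u z + c ^ 2 * ‖gradient u z‖ ^ 2) + _ at hsum
  have h1 : Real.exp (c * u z) * (c * lap u z + c ^ 2 * ‖gradient u z‖ ^ 2) ≤ 0 := by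
    have : c * lap u z + c ^ 2 * ‖gradient u z‖ ^ 2
      = c * (lap u z + c * ‖gradient u z‖ ^ 2) := by ring
    rw [this]
    exact mul_nonpos_of_nonneg_of_nonpos (Real.exp_pos _).le
      (mul_nonpos_of_nonneg_of_nonpos hcpos.le hs)
  have h2 : (((n + 1 : ℕ) : ℝ) * 1 - (n + 2) * 1) / R ^ 2 < 0 := by
    apply div_neg_of_neg_of_pos
    · push_cast; linarith
    · positivity
  linarith

/-- The abstract comparison: `exp (c u) ≥ 1`. -/
lemma comparison {n : ℕ} (hn : 2 ≤ n) {u : E n → ℝ}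
    (hu : ∀ z ∈ upperHalf n, ContDiffAt ℝ 2 u z)
    (hs : ∀ z ∈ upperHalf n, lap u z + (((n : ℝ) - 1) / 2) * ‖gradient u z‖ ^ 2 ≤ 0)
    (hlsc : ∀ z : E n, ycoord z = 0 → ∀ a < (1 : ℝ), ∀ᶠ w in 𝓝 z,
      0 < ycoord w → a < Real.exp ((((n : ℝ) - 1) / 2) * u w)) :
    ∀ z ∈ upperHalf n, 1 ≤ Real.exp ((((n : ℝ) - 1) / 2) * u z) := by
  set c : ℝ := ((n : ℝ) - 1) / 2 with hc
  intro z0 hz0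
  by_contra hlt
  push Not at hlt
  have hb0 : Tendsto (fun R => barrier n R z0) atTop (𝓝 0) := by
    have hi : Tendsto (fun R : ℝ => R⁻¹) atTop (𝓝 0) := tendsto_inv_atTop_zero
    have h : Tendsto (fun R : ℝ => (‖z0‖ ^ 2 - ycoord z0 ^ 2 - (n + 1) * ycoord z0 ^ 2) * (R⁻¹ * R⁻¹)
      + ((n + 1) * ycoord z0 + ycoord z0) * R⁻¹) atTop (𝓝 0) := by
      simpa using ((hi.mul hi).const_mul _).add (hi.const_mul ((n + 1) * ycoord z0 + ycoord z0))
    refine h.congr' ?_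
    filter_upwards [eventually_gt_atTop 0] with R hR
    unfold barrier
    field_simp
    ring
  obtain ⟨R, hbR, hR1, hRz⟩ := ((hb0.eventually (gt_mem_nhds (sub_pos.2 hlt))).and
    ((eventually_gt_atTop (0 : ℝ)).and (eventually_ge_atTop ‖z0‖))).exists
  set K : Set (E n) := {z | 0 ≤ ycoord z ∧ ycoord z ≤ R ∧ ‖z‖ ^ 2 - ycoord z ^ 2 ≤ R ^ 2} with hK
  have hyc := continuous_ycoord (n := n)
  have hKc : IsCompact K := by
    apply Metric.isCompact_of_isClosed_isBounded
    · exact (isClosed_le continuous_const hyc).inter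
        ((isClosed_le hyc continuous_const).inter (isClosed_le
          (show Continuous fun w : E n => ‖w‖ ^ 2 - ycoord w ^ 2 by fun_prop) continuous_const))
    · refine (Metric.isBounded_closedBall (x := (0 : E n)) (r := 2 * R)).subset ?_
      rintro z ⟨h1, h2, h3⟩
      rw [mem_closedBall_zero_iff]
      apply abs_le_of_sq_le_sq' _ (by positivity) |>.2
      nlinarith
  set G : E n → ℝ := fun z => if ycoord z = 0 then 1 else Real.exp (c * u z) with hG
  have hGup : ∀ z ∈ upperHalf n, G =ᶠ[𝓝 z] fun z => Real.exp (c * u z) := by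
    intro z hz
    filter_upwards [isOpen_upperHalf.mem_nhds hz] with w hw
    have : ycoord w ≠ 0 := ne_of_gt hw
    simp [hG, this]
  have hGl : LowerSemicontinuousOn G K := by
    intro z hz
    rcases hz.1.eq_or_lt with h0 | h0
    · intro a ha
      have ha' : a < 1 := by simpa [hG, ← h0] using ha
      filter_upwards [mem_nhdsWithin_of_mem_nhds (hlsc z h0.symm a ha'), self_mem_nhdsWithin]
        with w hw hwK
      rcases hwK.1.eq_or_lt with h | h
      · simpa [hG, ← h] using ha'
      · simpa [hG, h.ne'] using hw h
    · have : ContinuousAt G z := by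
        refine ContinuousAt.congr ?_ (hGup z h0).symm
        exact ((hu z h0).continuousAt.const_mul c).rexp
      exact this.continuousWithinAt.lowerSemicontinuousWithinAt
  have hFl : LowerSemicontinuousOn (fun z => G z + barrier n R z) K :=
    hGl.add (continuous_barrier n R).continuousOn.lowerSemicontinuousOn
  have hz0y : ycoord z0 ≤ R := by
    have h1 : ycoord z0 ^ 2 ≤ R ^ 2 := (sq_ycoord_le z0).trans (by gcongr)
    exact (abs_le_of_sq_le_sq' h1 hR1.le).2
  have hz0K : z0 ∈ K := by
    refine ⟨le_of_lt hz0, hz0y, ?_⟩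
    have : ‖z0‖ ^ 2 ≤ R ^ 2 := by gcongr
    nlinarith [sq_nonneg (ycoord z0)]
  obtain ⟨z, hzK, hzmin⟩ := hFl.exists_isMinOn ⟨z0, hz0K⟩ hKc
  have hlt1 : G z + barrier n R z < 1 := by
    refine lt_of_le_of_lt (hzmin hz0K) ?_
    have : G z0 = Real.exp (c * u z0) := (hGup z0 hz0).self_of_nhds
    simp only [this]
    linarith
  obtain ⟨hy0, hyR, hxR⟩ := hzK
  have hsq := sq_ycoord_le z
  have hn0 : (0 : ℝ) ≤ n := Nat.cast_nonneg n
  have hprod : 0 ≤ ((n : ℝ) + 1) * (ycoord z * (R - ycoord z)) :=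
    mul_nonneg (by linarith) (mul_nonneg hy0 (by linarith))
  have hbpos : 0 ≤ barrier n R z := by
    unfold barrier
    have : 0 ≤ ‖z‖ ^ 2 - ycoord z ^ 2 := by linarith
    positivity
  have hy0' : 0 < ycoord z := by
    rcases hy0.eq_or_lt with h | h
    · have : G z = 1 := by simp [hG, ← h]
      linarith
    · exact h
  have hGpos : 0 < G z := by
    rw [(hGup z hy0').self_of_nhds]; positivity
  have hb1 : barrier n R z < 1 := by linarith
  have hyR' : ycoord z < R := by
    refine lt_of_le_of_ne hyR fun h => ?_
    have h1 : ycoord z / R = 1 := by rw [h]; exact div_self hR1.ne'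
    have h2 : 0 ≤ (‖z‖ ^ 2 - ycoord z ^ 2 + (n + 1) * (ycoord z * (R - ycoord z))) / R ^ 2 :=
      div_nonneg (by linarith) (by positivity)
    unfold barrier at hb1
    linarith
  have hxR' : ‖z‖ ^ 2 - ycoord z ^ 2 < R ^ 2 := by
    refine lt_of_le_of_ne hxR fun h => ?_
    have h1 : 0 ≤ ycoord z / R := by positivity
    have h2 : 1 ≤ (‖z‖ ^ 2 - ycoord z ^ 2 + (n + 1) * (ycoord z * (R - ycoord z))) / R ^ 2 := by
      rw [le_div_iff₀ (by positivity)]; linarith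
    unfold barrier at hb1
    linarith
  have hKn : K ∈ 𝓝 z := by
    have h1 : ∀ᶠ w in 𝓝 z, 0 < ycoord w := hyc.continuousAt.eventually (lt_mem_nhds hy0')
    have h2 : ∀ᶠ w in 𝓝 z, ycoord w < R := hyc.continuousAt.eventually (gt_mem_nhds hyR')
    have h3 : ∀ᶠ w : E n in 𝓝 z, ‖w‖ ^ 2 - ycoord w ^ 2 < R ^ 2 :=
      (show Continuous fun w : E n => ‖w‖ ^ 2 - ycoord w ^ 2 by fun_prop).continuousAt.eventually
        (gt_mem_nhds hxR')
    filter_upwards [h1, h2, h3] with w a b d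
    exact ⟨a.le, b.le, d.le⟩
  refine no_local_min hn (hu z hy0') (hs z hy0') hR1 (fun z => G z + barrier n R z)
    (hzmin.isLocalMin hKn) ?_
  filter_upwards [hGup z hy0'] with w hw
  simp only [hw, hc]

/-- Monotonicity of `ρ / y` in the vertical direction. -/
lemma ratio_antitone {n : ℕ} {ρ : E n → ℝ}
    (hd : ∀ z ∈ upperHalf n, DifferentiableAt ℝ ρ z)
    (hgrad : ∀ z ∈ upperHalf n, ycoord z * ‖gradient ρ z‖ ≤ ρ z) (z : E n) (hz : ycoord z = 0) :
    AntitoneOn (fun t : ℝ => ρ (z + t • eY n) / t) (Ioi 0) := by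
  have hyl : ∀ t : ℝ, ycoord (z + t • eY n) = t := fun t => by
    rw [ycoord_add_smul, hz, ycoord_eY]; ring
  have hder : ∀ t ∈ Ioi (0 : ℝ), HasDerivAt (fun t : ℝ => ρ (z + t • eY n) / t)
      ((fderiv ℝ ρ (z + t • eY n) (eY n) * t - ρ (z + t • eY n) * 1) / t ^ 2) t := by
    intro t ht
    have hl : HasDerivAt (fun t : ℝ => z + t • eY n) (eY n) t := by
      simpa using ((hasDerivAt_id t).smul_const (eY n)).const_add z
    have h1 : z + t • eY n ∈ upperHalf n := by
      change 0 < ycoord _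
      rw [hyl]; exact ht
    exact ((hd _ h1).hasFDerivAt.comp_hasDerivAt t hl).div (hasDerivAt_id t) (ne_of_gt ht)
  refine antitoneOn_of_deriv_nonpos (convex_Ioi 0)
    (fun t ht => (hder t ht).continuousAt.continuousWithinAt) ?_ ?_
  · rw [interior_Ioi]
    exact fun t ht => (hder t ht).differentiableAt.differentiableWithinAt
  · rw [interior_Ioi]
    intro t ht
    rw [(hder t ht).deriv]
    have h1 : z + t • eY n ∈ upperHalf n := by
      change 0 < ycoord _
      rw [hyl]; exact ht
    have h2 := hgrad _ h1
    rw [hyl] at h2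
    have ht' : 0 < t := ht
    have h3 : fderiv ℝ ρ (z + t • eY n) (eY n) ≤ ‖gradient ρ (z + t • eY n)‖ := by
      have h4 := PiLp.norm_apply_le (gradient ρ (z + t • eY n)) (Fin.last n)
      rw [gradient_apply_coord] at h4
      exact (le_abs_self _).trans h4
    apply div_nonpos_of_nonpos_of_nonneg _ (sq_nonneg t)
    nlinarith

/-- Liouville-type theorem for compactified metrics: if `ρ > 0` is C² up to the
boundary, `ρ(x,0) = 0`, `lim_{y→0⁺} ρ/y = 1`, the scalar curvature of `g* = ρ²y^{-2}|dz|²`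
is nonnegative, and `|∇*ρ| ≤ 1`, then `ρ = y`. -/
theorem liouville_compactified_metric
    (n : ℕ) (hn : 2 ≤ n) (ρ : E n → ℝ)
    (hpos : ∀ z ∈ upperHalf n, 0 < ρ z)
    (hC2 : ContDiffOn ℝ 2 ρ {z : E n | 0 ≤ ycoord z})
    (hzero : ∀ z : E n, ycoord z = 0 → ρ z = 0)
    (hlim : ∀ x : EuclideanSpace ℝ (Fin n),
      Tendsto (fun y => ρ (pt x y) / y) (nhdsWithin 0 (Set.Ioi 0)) (nhds 1))
    (hscal : ∀ z ∈ upperHalf n,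
      lap (fun z => Real.log (ρ z / ycoord z)) z +
        (((n : ℝ) - 1) / 2) * ‖gradient (fun z => Real.log (ρ z / ycoord z)) z‖ ^ 2 ≤ 0)
    (hgrad : ∀ z ∈ upperHalf n, ycoord z * ‖gradient ρ z‖ ≤ ρ z) :
    ∀ z ∈ upperHalf n, ρ z = ycoord z := by
  have hnh : ∀ z ∈ upperHalf n, {z : E n | 0 ≤ ycoord z} ∈ 𝓝 z := fun z hz =>
    mem_of_superset (isOpen_upperHalf.mem_nhds hz) fun w (hw : 0 < ycoord w) => hw.le
  have hC : ∀ z ∈ upperHalf n, ContDiffAt ℝ 2 ρ z := fun z hz => hC2.contDiffAt (hnh z hz)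
  have hyC : ContDiff ℝ 2 (ycoord : E n → ℝ) := by
    unfold ycoord
    fun_prop
  have hu : ∀ z ∈ upperHalf n, ContDiffAt ℝ 2 (fun z => Real.log (ρ z / ycoord z)) z := by
    intro z hz
    have hz' : ycoord z ≠ 0 := ne_of_gt hz
    exact ((hC z hz).div hyC.contDiffAt hz').log (div_ne_zero (hpos z hz).ne' hz')
  have hanti := ratio_antitone (ρ := ρ)
    (fun z hz => (hC z hz).differentiableAt (by norm_num)) hgrad
  have hlim' : ∀ z : E n, ycoord z = 0 →
      Tendsto (fun t : ℝ => ρ (z + t • eY n) / t) (𝓝[>] 0) (𝓝 1) := by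
    intro z hz
    have := hlim (xpart z)
    simpa only [pt_xpart, hz, sub_zero] using this
  have hle : ∀ z ∈ upperHalf n, ρ z / ycoord z ≤ 1 := by
    intro z hz
    have hz' : 0 < ycoord z := hz
    set b : E n := z + (-ycoord z) • eY n with hb
    have hb0 : ycoord b = 0 := by rw [hb, ycoord_add_smul, ycoord_eY]; ring
    have hbz : b + ycoord z • eY n = z := by rw [hb]; module
    refine ge_of_tendsto (hlim' b hb0) ?_
    filter_upwards [Ioo_mem_nhdsGT hz'] with t ht
    have := hanti b hb0 (show t ∈ Ioi 0 from ht.1) (show ycoord z ∈ Ioi 0 from hz') ht.2.le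
    simpa only [hbz] using this
  have hcpos : 0 < ((n : ℝ) - 1) / 2 := by
    have : (2 : ℝ) ≤ n := by exact_mod_cast hn
    linarith
  have hge := comparison hn hu hscal ?_
  · intro z hz
    have hz' : 0 < ycoord z := hz
    have hr : 0 < ρ z / ycoord z := div_pos (hpos z hz) hz'
    have h1 := hge z hz
    rw [Real.one_le_exp_iff] at h1
    have h2 : 0 ≤ Real.log (ρ z / ycoord z) := nonneg_of_mul_nonneg_right h1 hcpos
    have h3 : 1 ≤ ρ z / ycoord z := by
      rwa [Real.log_nonneg_iff hr] at h2
    have h4 := le_antisymm (hle z hz) h3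
    rwa [div_eq_one_iff_eq hz'.ne'] at h4
  · intro z hz a ha
    have ht : Tendsto (fun t : ℝ => Real.exp (((n : ℝ) - 1) / 2 *
        Real.log (ρ (z + t • eY n) / t))) (𝓝[>] 0) (𝓝 1) := by
      have := (((hlim' z hz).log one_ne_zero).const_mul (((n : ℝ) - 1) / 2)).rexp
      simpa using this
    obtain ⟨s, hs, hs0⟩ := ((ht.eventually (lt_mem_nhds ha)).and self_mem_nhdsWithin).exists
    have hs0' : 0 < s := hs0
    have hys : ycoord (z + s • eY n) = s := by rw [ycoord_add_smul, hz, ycoord_eY]; ring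
    have hsU : z + s • eY n ∈ upperHalf n := by
      change 0 < ycoord _
      rwa [hys]
    have hc1 : ContinuousAt (fun w => Real.exp (((n : ℝ) - 1) / 2 *
        Real.log (ρ w / ycoord w))) (z + s • eY n) :=
      ((hu _ hsU).continuousAt.const_mul _).rexp
    have hm : Tendsto (fun w : E n => w + (s - ycoord w) • eY n) (𝓝 z) (𝓝 (z + s • eY n)) := by
      have hyc := continuous_ycoord (n := n)
      have : Continuous (fun w : E n => w + (s - ycoord w) • eY n) := by fun_prop
      have h := this.tendsto z
      rwa [hz, sub_zero] at h
    have he := hm.eventually (hc1.eventually (lt_mem_nhds (a := a) (by simpa only [hys] using hs)))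
    have hlt : ∀ᶠ w in 𝓝 z, ycoord w < s :=
      continuous_ycoord.continuousAt.eventually (gt_mem_nhds (by rwa [hz]))
    filter_upwards [he, hlt] with w hw hws hw0
    refine hw.trans_le ?_
    have hyw : ycoord (w + (s - ycoord w) • eY n) = s := by
      rw [ycoord_add_smul, ycoord_eY]; ring
    have hwU : w + (s - ycoord w) • eY n ∈ upperHalf n := by
      change 0 < ycoord _
      rwa [hyw]
    set b : E n := w + (-ycoord w) • eY n with hb
    have hb0 : ycoord b = 0 := by rw [hb, ycoord_add_smul, ycoord_eY]; ring
    have hbw : b + ycoord w • eY n = w := by rw [hb]; module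
    have hbs : b + s • eY n = w + (s - ycoord w) • eY n := by rw [hb]; module
    have h := hanti b hb0 (show ycoord w ∈ Ioi 0 from hw0) hs0 hws.le
    simp only [hbw, hbs] at h
    rw [hyw]
    have hp : 0 < ρ (w + (s - ycoord w) • eY n) / s := div_pos (hpos _ hwU) hs0'
    gcongr

end
end

section
/- Let n ≥ 2 and let v be a C² function on ℝ₊^{n+1} satisfying y²Δv − (n−1)y∂_y v + n = 0 on ℝ₊^{n+1} (i.e. −Δ₊v − n = 0 for the hyperbolic Laplacian). Define w(x,y) := 1 − e^{v(x,y)}/y. Assume: (1) w belongs to H̃^{1,0}(ℝ₊^{n+1}) and lim_{y→0⁺} w(x,y) = 0 for every x ∈ ℝⁿ; (2) y|∇v| ≤ 1 on ℝ₊^{n+1} (this is equivalent to the nonnegativity of the scalar curvature R* of the Fefferman–Graham compactified metric g* := e^{2v} y^{−2}|dz|², via R* = n(n−1)e^{−2v}(1 − y²|∇v|²)). Then e^{v(x,y)} = y for all (x,y) ∈ ℝ₊^{n+1}, i.e. g* is the Euclidean metric. -/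
open MeasureTheory Filter Set Topology
open scoped ENNReal NNReal

noncomputable section

lemma aux_second_deriv_nonpos {G G1 : ℝ → ℝ} {c : ℝ} (hmax : IsLocalMax G 0)
    (h1 : ∀ᶠ t in 𝓝 (0 : ℝ), HasDerivAt G (G1 t) t) (h2 : HasDerivAt G1 c 0) : c ≤ 0 := by
  by_contra hc
  push Not at hc
  have hev : deriv G =ᶠ[𝓝 0] G1 := by
    filter_upwards [h1] with t ht using ht.deriv
  have hdd : deriv (deriv G) 0 = c := by
    rw [hev.deriv_eq]; exact h2.deriv
  have hmin : IsLocalMin G 0 :=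
    isLocalMin_of_deriv_deriv_pos (by rw [hdd]; exact hc) hmax.deriv_eq_zero
      h1.self_of_nhds.continuousAt
  have hconst : G =ᶠ[𝓝 0] fun _ => G 0 := by
    filter_upwards [hmin, hmax] with t h h' using le_antisymm h' h
  have h3 : deriv G =ᶠ[𝓝 0] fun _ => 0 := by
    have := hconst.deriv
    simpa using this
  have : deriv (deriv G) 0 = 0 := by rw [h3.deriv_eq]; simp
  linarith

lemma aux_ycoord_add {n : ℕ} (z e : E n) (t : ℝ) :
    ycoord (z + t • e) = ycoord z + t * ycoord e := by
  simp [ycoord]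

lemma aux_ycoord_eY (n : ℕ) : ycoord (eY n) = 1 := by
  simp [ycoord, eY]

lemma aux_norm_eY (n : ℕ) : ‖eY n‖ = 1 := by
  simp [eY]

lemma aux_cont_ycoord (n : ℕ) : Continuous (ycoord : E n → ℝ) := by
  unfold ycoord; fun_prop

lemma aux_open (n : ℕ) : IsOpen (upperHalf n) :=
  isOpen_lt continuous_const (aux_cont_ycoord n)

lemma aux_pt {n : ℕ} (b : E n) (hb : ycoord b = 0) (s : ℝ) :
    b + s • eY n = pt (WithLp.toLp 2 (fun i : Fin n => b i.castSucc)) s := by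
  ext i
  refine Fin.lastCases ?_ (fun j => ?_) i
  · simp [pt, eY, ycoord] at *
    simp [hb]
  · simp [pt, eY]

lemma aux_diff {n : ℕ} {v : E n → ℝ} (hC2 : ContDiffOn ℝ 2 v (upperHalf n))
    {z : E n} (hz : z ∈ upperHalf n) : DifferentiableAt ℝ v z :=
  (hC2.contDiffAt ((aux_open n).mem_nhds hz)).differentiableAt (by norm_num)

lemma aux_ray {n : ℕ} {v : E n → ℝ} (hC2 : ContDiffOn ℝ 2 v (upperHalf n))
    (z e : E n) (t : ℝ) (hz : z + t • e ∈ upperHalf n) :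
    HasDerivAt (fun s : ℝ => v (z + s • e)) (fderiv ℝ v (z + t • e) e) t := by
  have h1 : HasDerivAt (fun s : ℝ => z + s • e) e t := by
    simpa using ((hasDerivAt_id t).smul_const e).const_add z
  exact (aux_diff hC2 hz).hasFDerivAt.comp_hasDerivAt t h1

lemma aux_ray2 {n : ℕ} {v : E n → ℝ} (hC2 : ContDiffOn ℝ 2 v (upperHalf n))
    (z e : E n) (hz : z ∈ upperHalf n) :
    HasDerivAt (fun s : ℝ => fderiv ℝ v (z + s • e) e)
      (fderiv ℝ (fun w => fderiv ℝ v w e) z e) 0 := by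
  have h1 : HasDerivAt (fun s : ℝ => z + s • e) e 0 := by
    simpa using ((hasDerivAt_id (0 : ℝ)).smul_const e).const_add z
  have hc : ContDiffAt ℝ 1 (fderiv ℝ v) z :=
    (hC2.contDiffAt ((aux_open n).mem_nhds hz)).fderiv_right (by norm_num)
  have hd : DifferentiableAt ℝ (fun w => fderiv ℝ v w e) z :=
    (hc.differentiableAt (by norm_num)).clm_apply (differentiableAt_const e)
  have hd' : HasFDerivAt (fun w => fderiv ℝ v w e)
      (fderiv ℝ (fun w => fderiv ℝ v w e) z) (z + (0 : ℝ) • e) := by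
    simpa using hd.hasFDerivAt
  exact hd'.comp_hasDerivAt (0 : ℝ) h1

lemma aux_fderiv_bound {n : ℕ} (v : E n → ℝ) (z e : E n) :
    |fderiv ℝ v z e| ≤ ‖gradient v z‖ * ‖e‖ := by
  have : ‖gradient v z‖ = ‖fderiv ℝ v z‖ := by simp [gradient]
  rw [this]
  simpa using (fderiv ℝ v z).le_opNorm e

lemma aux_y_bound {n : ℕ} (v : E n → ℝ) (z : E n) (hz : 0 < ycoord z)
    (hg : ycoord z * ‖gradient v z‖ ≤ 1) : |fderiv ℝ v z (eY n)| ≤ 1 / ycoord z := by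
  have := aux_fderiv_bound v z (eY n)
  rw [aux_norm_eY, mul_one] at this
  refine this.trans ?_
  rw [le_div_iff₀ hz]; linarith

/-- monotonicity of `log y - v` and `log y + v` along vertical lines -/
lemma aux_mono {n : ℕ} {v : E n → ℝ} (hC2 : ContDiffOn ℝ 2 v (upperHalf n))
    (hgrad : ∀ z ∈ upperHalf n, ycoord z * ‖gradient v z‖ ≤ 1)
    (b : E n) (hb : ycoord b = 0) :
    MonotoneOn (fun s : ℝ => Real.log s - v (b + s • eY n)) (Ioi 0) ∧
    MonotoneOn (fun s : ℝ => Real.log s + v (b + s • eY n)) (Ioi 0) := by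
  have hy : ∀ s : ℝ, ycoord (b + s • eY n) = s := by
    intro s; rw [aux_ycoord_add, aux_ycoord_eY, hb]; ring
  have hmem : ∀ s : ℝ, 0 < s → b + s • eY n ∈ upperHalf n := by
    intro s hs; change 0 < ycoord _; rw [hy]; exact hs
  have hbd : ∀ s : ℝ, 0 < s → |fderiv ℝ v (b + s • eY n) (eY n)| ≤ s⁻¹ := by
    intro s hs
    have := aux_y_bound v (b + s • eY n) (hmem s hs) (hgrad _ (hmem s hs))
    rwa [hy, one_div] at this
  have hd1 : ∀ s : ℝ, 0 < s → HasDerivAt (fun s : ℝ => Real.log s - v (b + s • eY n))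
      (s⁻¹ - fderiv ℝ v (b + s • eY n) (eY n)) s := fun s hs =>
    (Real.hasDerivAt_log hs.ne').sub (aux_ray hC2 b (eY n) s (hmem s hs))
  have hd2 : ∀ s : ℝ, 0 < s → HasDerivAt (fun s : ℝ => Real.log s + v (b + s • eY n))
      (s⁻¹ + fderiv ℝ v (b + s • eY n) (eY n)) s := fun s hs =>
    (Real.hasDerivAt_log hs.ne').add (aux_ray hC2 b (eY n) s (hmem s hs))
  constructor
  · refine monotoneOn_of_deriv_nonneg (convex_Ioi 0)
      (fun s hs => (hd1 s hs).continuousAt.continuousWithinAt)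
      (fun s hs => (hd1 s (interior_subset hs)).differentiableAt.differentiableWithinAt) ?_
    intro s hs
    have hs' : 0 < s := interior_subset hs
    rw [(hd1 s hs').deriv]
    linarith [(abs_le.1 (hbd s hs')).2]
  · refine monotoneOn_of_deriv_nonneg (convex_Ioi 0)
      (fun s hs => (hd2 s hs).continuousAt.continuousWithinAt)
      (fun s hs => (hd2 s (interior_subset hs)).differentiableAt.differentiableWithinAt) ?_
    intro s hs
    have hs' : 0 < s := interior_subset hs
    rw [(hd2 s hs').deriv]
    linarith [(abs_le.1 (hbd s hs')).1]

/-- horizontal Lipschitz bound -/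
lemma aux_horiz {n : ℕ} {v : E n → ℝ} (hC2 : ContDiffOn ℝ 2 v (upperHalf n))
    (hgrad : ∀ z ∈ upperHalf n, ycoord z * ‖gradient v z‖ ≤ 1)
    (R : ℝ) (hR : 0 < R) (z z' : E n) (hz : ycoord z = R) (hz' : ycoord z' = R)
    (hd : ‖z' - z‖ ≤ R) : v z - 1 ≤ v z' := by
  have hconv : Convex ℝ {z : E n | ycoord z = R} := by
    intro a ha b hb s t hs ht hst
    simp only [mem_ofPred_eq, ycoord] at *
    simp [ha, hb]; rw [← add_mul, hst, one_mul]
  have key := hconv.norm_image_sub_le_of_norm_hasFDerivWithin_le (f := v)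
    (f' := fun z => fderiv ℝ v z) (C := 1 / R) (x := z) (y := z')
    (fun x hx => (aux_diff hC2 (by
      change 0 < ycoord x; rw [mem_ofPred_eq] at hx; rw [hx]; exact hR)).hasFDerivAt.hasFDerivWithinAt)
    (fun x hx => by
      rw [mem_ofPred_eq] at hx
      have h := hgrad x (by change 0 < ycoord x; rw [hx]; exact hR)
      have h2 : ‖gradient v x‖ = ‖fderiv ℝ v x‖ := by simp [gradient]
      rw [hx, h2] at h
      rw [le_div_iff₀ hR]; linarith) hz hz'
  have h3 : 1 / R * ‖z' - z‖ ≤ 1 := by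
    rw [one_div, inv_mul_le_iff₀ hR]; linarith
  have := (abs_le.1 ((Real.norm_eq_abs _).symm ▸ key.trans h3)).1
  linarith

/-- the barrier -/
def auxBar {n : ℕ} (z0 : E n) (κ R : ℝ) (z : E n) : ℝ :=
  κ * (‖z - z0‖ ^ 2 - (ycoord z - ycoord z0) ^ 2 + ((n : ℝ) + 2) * R * ycoord z
    - ((n : ℝ) + 1) * ycoord z ^ 2)

lemma aux_no_max {n : ℕ} (hn : 2 ≤ n) {v : E n → ℝ} (hC2 : ContDiffOn ℝ 2 v (upperHalf n))
    (hpde : ∀ z ∈ upperHalf n,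
      (ycoord z) ^ 2 * lap v z - ((n : ℝ) - 1) * ycoord z * partialY v z + (n : ℝ) = 0)
    (hgrad : ∀ z ∈ upperHalf n, ycoord z * ‖gradient v z‖ ≤ 1)
    (z0 : E n) (κ R : ℝ) (hκ : 0 < κ) (p : E n) (hp : p ∈ upperHalf n)
    (hmax : IsLocalMax (fun z => Real.log (ycoord z) - v z - auxBar z0 κ R z) p) : False := by
  have hp' : 0 < ycoord p := hp
  have key : ∀ i : Fin (n + 1),
      - (ycoord (EuclideanSpace.single i (1 : ℝ) : E n)) ^ 2 / (ycoord p) ^ 2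
      - fderiv ℝ (fun w => fderiv ℝ v w (EuclideanSpace.single i (1 : ℝ))) p
          (EuclideanSpace.single i (1 : ℝ))
      - κ * (2 - 2 * (ycoord (EuclideanSpace.single i (1 : ℝ) : E n)) ^ 2
        - ((n : ℝ) + 1) * (2 * (ycoord (EuclideanSpace.single i (1 : ℝ) : E n)) ^ 2)) ≤ 0 := by
    intro i
    set e : E n := EuclideanSpace.single i (1 : ℝ) with he
    have hne : ‖e‖ = 1 := by simp [he]
    set d := ycoord e
    set y := ycoord p
    have hray : Continuous (fun t : ℝ => p + t • e) := by fun_prop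
    have hmax' : IsLocalMax (fun t : ℝ => Real.log (ycoord (p + t • e)) - v (p + t • e)
        - auxBar z0 κ R (p + t • e)) 0 := by
      have h0 : Tendsto (fun t : ℝ => p + t • e) (𝓝 0) (𝓝 p) := by
        simpa using hray.tendsto 0
      have := h0.eventually hmax
      simpa [IsLocalMax, IsMaxFilter] using this
    refine aux_second_deriv_nonpos (G1 := fun t => d / (y + t * d) - fderiv ℝ v (p + t • e) e
      - κ * (2 * inner ℝ (p - z0) e + 2 * t - 2 * (y + t * d - ycoord z0) * d
        + ((n : ℝ) + 2) * R * d - ((n : ℝ) + 1) * (2 * (y + t * d) * d))) hmax' ?_ ?_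
    · have hmem : ∀ᶠ t : ℝ in 𝓝 0, p + t • e ∈ upperHalf n :=
        hray.continuousAt.eventually_mem ((aux_open n).mem_nhds (by simpa using hp))
      filter_upwards [hmem] with t ht
      have hyt : 0 < y + t * d := by
        have : 0 < ycoord (p + t • e) := ht
        rwa [aux_ycoord_add] at this
      have hlin : HasDerivAt (fun t : ℝ => y + t * d) d t := by
        simpa using ((hasDerivAt_id t).mul_const d).const_add y
      have hfun : (fun t : ℝ => Real.log (ycoord (p + t • e)) - v (p + t • e)
          - auxBar z0 κ R (p + t • e)) = fun t : ℝ => Real.log (y + t * d) - v (p + t • e)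
          - κ * (‖p - z0‖ ^ 2 + 2 * inner ℝ (p - z0) e * t + t ^ 2
            - (y + t * d - ycoord z0) ^ 2 + ((n : ℝ) + 2) * R * (y + t * d)
            - ((n : ℝ) + 1) * (y + t * d) ^ 2) := by
        funext s
        have hs : ‖p + s • e - z0‖ ^ 2 = ‖p - z0‖ ^ 2 + 2 * inner ℝ (p - z0) e * s + s ^ 2 := by
          rw [show p + s • e - z0 = (p - z0) + s • e by abel, norm_add_sq_real, norm_smul, hne,
            inner_smul_right]
          simp; ring
        unfold auxBar
        rw [aux_ycoord_add, hs]
      rw [hfun]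
      refine ((hlin.log hyt.ne').sub (aux_ray hC2 p e t ht)).sub (HasDerivAt.const_mul κ ?_)
      have a1 : HasDerivAt (fun t : ℝ => ‖p - z0‖ ^ 2 + 2 * inner ℝ (p - z0) e * t + t ^ 2)
          (2 * inner ℝ (p - z0) e + 2 * t) t := by
        exact ((((hasDerivAt_id t).const_mul (2 * inner ℝ (p - z0) e)).const_add
          (‖p - z0‖ ^ 2)).add (hasDerivAt_pow 2 t)).congr_deriv (by simp)
      have a2 : HasDerivAt (fun t : ℝ => (y + t * d - ycoord z0) ^ 2)
          (2 * (y + t * d - ycoord z0) * d) t := by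
        exact ((hlin.sub_const (ycoord z0)).pow 2).congr_deriv (by simp)
      have a3 : HasDerivAt (fun t : ℝ => (y + t * d) ^ 2) (2 * (y + t * d) * d) t := by
        exact (hlin.pow 2).congr_deriv (by simp)
      exact ((a1.sub a2).add (hlin.const_mul (((n : ℝ) + 2) * R))).sub
        (a3.const_mul ((n : ℝ) + 1))
    · have hlin : HasDerivAt (fun t : ℝ => y + t * d) d 0 := by
        simpa using ((hasDerivAt_id (0 : ℝ)).mul_const d).const_add y
      have b1 : HasDerivAt (fun t : ℝ => d / (y + t * d)) (- d ^ 2 / y ^ 2) 0 := by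
        exact ((hasDerivAt_const (0 : ℝ) d).div hlin (by simpa using hp'.ne')).congr_deriv
          (by simp; ring)
      refine (b1.sub (aux_ray2 hC2 p e hp)).sub (HasDerivAt.const_mul κ ?_)
      have b2 : HasDerivAt (fun t : ℝ => 2 * inner ℝ (p - z0) e + 2 * t) 2 0 := by
        simpa using ((hasDerivAt_id (0 : ℝ)).const_mul 2).const_add (2 * inner ℝ (p - z0) e)
      have b3 := ((hlin.sub_const (ycoord z0)).const_mul 2).mul_const d
      have b4 := (hlin.const_mul 2).mul_const d
      exact (((b2.sub b3).add_const (((n : ℝ) + 2) * R * d)).sub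
        (b4.const_mul ((n : ℝ) + 1))).congr_deriv (by ring)
  have hsum := Finset.sum_nonpos (s := Finset.univ) (fun i _ => key i)
  have hsq : ∑ i : Fin (n + 1), (ycoord (EuclideanSpace.single i (1 : ℝ) : E n)) ^ 2 = 1 := by
    have : ∀ i : Fin (n + 1), (ycoord (EuclideanSpace.single i (1 : ℝ) : E n)) ^ 2
        = if Fin.last n = i then 1 else 0 := by
      intro i
      by_cases h : Fin.last n = i <;> simp [ycoord, h]
    simp [this]
  have hval : - 1 / (ycoord p) ^ 2 - lap v p + 2 * κ ≤ 0 := by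
    have e1 : ∑ i : Fin (n + 1),
      (- (ycoord (EuclideanSpace.single i (1 : ℝ) : E n)) ^ 2 / (ycoord p) ^ 2
      - fderiv ℝ (fun w => fderiv ℝ v w (EuclideanSpace.single i (1 : ℝ))) p
          (EuclideanSpace.single i (1 : ℝ))
      - κ * (2 - 2 * (ycoord (EuclideanSpace.single i (1 : ℝ) : E n)) ^ 2
        - ((n : ℝ) + 1) * (2 * (ycoord (EuclideanSpace.single i (1 : ℝ) : E n)) ^ 2)))
        = - 1 / (ycoord p) ^ 2 - lap v p + 2 * κ := by
      rw [Finset.sum_sub_distrib, Finset.sum_sub_distrib, ← Finset.sum_div, ← Finset.mul_sum,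
        Finset.sum_sub_distrib, Finset.sum_sub_distrib, ← Finset.mul_sum, ← Finset.mul_sum,
        ← Finset.mul_sum, Finset.sum_neg_distrib, hsq]
      simp only [lap, Finset.sum_const, Finset.card_univ, Fintype.card_fin, nsmul_eq_mul]
      push_cast
      ring
    rw [← e1]; exact hsum
  have hb := (abs_le.1 (aux_y_bound v p hp' (hgrad p hp))).2
  have hb' : ycoord p * partialY v p ≤ 1 := by
    unfold partialY
    rw [le_div_iff₀ hp'] at hb; linarith
  have hpd := hpde p hp
  have hn' : (2 : ℝ) ≤ n := by exact_mod_cast hn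
  have hy2 : 0 < ycoord p ^ 2 := by positivity
  have : - 1 - ycoord p ^ 2 * lap v p + 2 * κ * ycoord p ^ 2 ≤ 0 := by
    have h := mul_le_mul_of_nonneg_right hval hy2.le
    have h2 : (- 1 / (ycoord p) ^ 2 - lap v p + 2 * κ) * ycoord p ^ 2
      = - 1 - ycoord p ^ 2 * lap v p + 2 * κ * ycoord p ^ 2 := by
      field_simp
    rw [h2] at h; simpa using h
  nlinarith [mul_pos hκ hy2, mul_nonneg (by linarith : (0:ℝ) ≤ (n:ℝ) - 1) (sub_nonneg.2 hb')]

lemma aux_main {n : ℕ} (hn : 2 ≤ n) {v : E n → ℝ} (hC2 : ContDiffOn ℝ 2 v (upperHalf n))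
    (hpde : ∀ z ∈ upperHalf n,
      (ycoord z) ^ 2 * lap v z - ((n : ℝ) - 1) * ycoord z * partialY v z + (n : ℝ) = 0)
    (hgrad : ∀ z ∈ upperHalf n, ycoord z * ‖gradient v z‖ ≤ 1)
    (hf0 : ∀ b : E n, ycoord b = 0 →
      Tendsto (fun s : ℝ => Real.log s - v (b + s • eY n)) (𝓝[>] 0) (𝓝 0))
    (hdec : ∀ z : E n, ycoord (z - ycoord z • eY n) = 0 ∧
      z - ycoord z • eY n + ycoord z • eY n = z)
    (z0 : E n) (hz0 : z0 ∈ upperHalf n) (R : ℝ) (hR1 : 1 ≤ R) (hR : ycoord z0 ≤ R)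
    (ε : ℝ) (hε : 0 < ε) :
    Real.log (ycoord z0) - v z0
      ≤ (2 * Real.log R + (1 + |v z0| + |Real.log (ycoord z0)|)) / R
        * (((n : ℝ) + 2) * ycoord z0) + ε := by
  have hy0 : 0 < ycoord z0 := hz0
  have hR0 : 0 < R := by linarith
  have hlogR : 0 ≤ Real.log R := Real.log_nonneg hR1
  set M : ℝ := 2 * Real.log R + (1 + |v z0| + |Real.log (ycoord z0)|) with hM
  have hMpos : 0 < M := by positivity
  set a : E n := z0 - ycoord z0 • eY n with ha
  have ha0 : ycoord a = 0 := (hdec z0).1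
  have haz : a + ycoord z0 • eY n = z0 := (hdec z0).2
  have hyb : ∀ b : E n, ycoord b = 0 → ∀ s : ℝ, ycoord (b + s • eY n) = s := by
    intro b hb s; rw [aux_ycoord_add, aux_ycoord_eY, hb]; ring
  -- orthogonal decomposition
  have horth : ∀ z : E n, ‖z - z0‖ ^ 2 - (ycoord z - ycoord z0) ^ 2
      = ‖(z - ycoord z • eY n) - a‖ ^ 2 := by
    intro z
    have h1 : z - z0 = ((z - ycoord z • eY n) - a) + (ycoord z - ycoord z0) • eY n := by
      rw [ha, sub_smul]; abel
    have h2 : inner ℝ ((z - ycoord z • eY n) - a) (eY n) = 0 := by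
      have h3 : ∀ u : E n, inner ℝ u (eY n) = ycoord u := by
        intro u; simp [eY, ycoord, EuclideanSpace.inner_single_right]
      rw [inner_sub_left, h3, h3, (hdec z).1, ha0, sub_zero]
    rw [h1, norm_add_sq_real, inner_smul_right, h2, norm_smul, aux_norm_eY]
    simp
  -- the growth bound
  have hgrow : ∀ z : E n, 0 < ycoord z → ycoord z ≤ R → ‖(z - ycoord z • eY n) - a‖ ≤ R →
      Real.log (ycoord z) - v z ≤ M := by
    intro z hz hzR hzd
    obtain ⟨hb, hbz⟩ := hdec z
    have h1 := (aux_mono hC2 hgrad _ hb).1 (mem_Ioi.2 hz) (mem_Ioi.2 hR0) hzR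
    simp only [hbz] at h1
    have h2 := (aux_mono hC2 hgrad _ ha0).2 (mem_Ioi.2 hy0) (mem_Ioi.2 hR0) hR
    simp only [haz] at h2
    have h3 := aux_horiz hC2 hgrad R hR0 (a + R • eY n) (z - ycoord z • eY n + R • eY n)
      (hyb _ ha0 R) (hyb _ hb R) (by rw [add_sub_add_right_eq_sub]; exact hzd)
    have h4 := neg_abs_le (v z0)
    have h5 := neg_abs_le (Real.log (ycoord z0))
    rw [hM]; linarith
  -- Dini
  have hDini : ∃ δ : ℝ, 0 < δ ∧ δ ≤ ycoord z0 ∧ ∀ b : E n, ycoord b = 0 → ‖b - a‖ ≤ R →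
      Real.log δ - v (b + δ • eY n) < ε := by
    have hcomp : IsCompact (Metric.closedBall a R ∩ {b : E n | ycoord b = 0}) :=
      (isCompact_closedBall a R).inter_right
        (isClosed_eq (aux_cont_ycoord n) continuous_const)
    have hpos : ∀ k : ℕ, (0 : ℝ) < ycoord z0 / ((k : ℝ) + 1) := fun k => by positivity
    have hU := Antitone.tendstoUniformlyOn_of_forall_tendsto
      (F := fun (k : ℕ) (b : E n) => Real.log (ycoord z0 / ((k : ℝ) + 1))
        - v (b + (ycoord z0 / ((k : ℝ) + 1)) • eY n)) (f := fun _ => (0 : ℝ)) hcomp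
      (fun k => by
        refine continuousOn_const.sub (hC2.continuousOn.comp (by fun_prop) ?_)
        intro b hb
        change 0 < ycoord _
        rw [hyb b hb.2]; exact hpos k)
      (fun b hb k l hkl => (aux_mono hC2 hgrad b hb.2).1 (mem_Ioi.2 (hpos l))
        (mem_Ioi.2 (hpos k)) (by gcongr))
      continuousOn_const
      (fun b hb => (hf0 b hb.2).comp (tendsto_nhdsWithin_iff.2
        ⟨tendsto_const_nhds.div_atTop (tendsto_atTop_add_const_right _ _
          tendsto_natCast_atTop_atTop), Eventually.of_forall hpos⟩))
    rw [Metric.tendstoUniformlyOn_iff] at hU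
    obtain ⟨k, hk⟩ := (hU ε hε).exists
    refine ⟨_, hpos k, div_le_self hy0.le (by linarith [k.cast_nonneg (α := ℝ)]), ?_⟩
    intro b hb hba
    have := hk b ⟨by rwa [mem_closedBall_iff_norm], hb⟩
    rw [dist_comm, Real.dist_eq, sub_zero] at this
    exact (le_abs_self _).trans_lt this
  obtain ⟨δ, hδ, hδy, hDini⟩ := hDini
  set κ : ℝ := M / R ^ 2 with hκ
  have hκpos : 0 < κ := by positivity
  have hκR : κ * R ^ 2 = M := by rw [hκ]; field_simp
  have hcq : Continuous (fun z : E n => (z - ycoord z • eY n) - a) := by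
    have := aux_cont_ycoord n
    fun_prop
  have hcy := aux_cont_ycoord n
  set K : Set (E n) := {z | ‖(z - ycoord z • eY n) - a‖ ≤ R ∧ δ ≤ ycoord z ∧ ycoord z ≤ R} with hK
  have hKcl : IsClosed K :=
    (isClosed_le hcq.norm continuous_const).inter
      ((isClosed_le continuous_const hcy).inter (isClosed_le hcy continuous_const))
  have hKcomp : IsCompact K := by
    refine (isCompact_closedBall a (2 * R)).of_isClosed_subset hKcl ?_
    rintro z ⟨h1, h2, h3⟩
    rw [mem_closedBall_iff_norm]
    have h4 : z - a = ((z - ycoord z • eY n) - a) + ycoord z • eY n := by abel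
    rw [h4]
    refine (norm_add_le _ _).trans ?_
    rw [norm_smul, aux_norm_eY, mul_one, Real.norm_eq_abs, abs_of_pos (hδ.trans_le h2)]
    linarith
  have hz0K : z0 ∈ K := ⟨by rw [← ha, sub_self, norm_zero]; exact hR0.le, hδy, hR⟩
  have hcont : ContinuousOn (fun z => Real.log (ycoord z) - v z - auxBar z0 κ R z) K := by
    refine ((hcy.continuousOn.log fun z hz => (hδ.trans_le hz.2.1).ne').sub
      (hC2.continuousOn.mono fun z hz => hδ.trans_le hz.2.1)).sub ?_
    apply Continuous.continuousOn
    unfold auxBar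
    fun_prop
  obtain ⟨p, hpK, hpmax⟩ := hKcomp.exists_isMaxOn ⟨z0, hz0K⟩ hcont
  have hpy : 0 < ycoord p := hδ.trans_le hpK.2.1
  have hbar : auxBar z0 κ R p = κ * (‖(p - ycoord p • eY n) - a‖ ^ 2
      + ((n : ℝ) + 2) * R * ycoord p - ((n : ℝ) + 1) * ycoord p ^ 2) := by
    unfold auxBar; rw [horth]
  have hn0 : (0 : ℝ) ≤ n := n.cast_nonneg
  have hquad : 0 ≤ ((n : ℝ) + 2) * R * ycoord p - ((n : ℝ) + 1) * ycoord p ^ 2 := by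
    have := mul_nonneg hpy.le (sub_nonneg.2 hpK.2.2)
    nlinarith [mul_nonneg hn0 this, mul_pos hR0 hpy]
  have hgp : Real.log (ycoord p) - v p - auxBar z0 κ R p ≤ ε := by
    have hfM := hgrow p hpy hpK.2.2 hpK.1
    rcases eq_or_lt_of_le hpK.1 with h1 | h1
    · have : M ≤ auxBar z0 κ R p := by
        rw [hbar, h1, ← hκR]
        exact mul_le_mul_of_nonneg_left (by linarith) hκpos.le
      linarith
    rcases eq_or_lt_of_le hpK.2.1 with h2 | h2
    · have h3 := hDini _ (hdec p).1 hpK.1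
      have h4 : 0 ≤ auxBar z0 κ R p := by
        rw [hbar]
        exact mul_nonneg hκpos.le (by linarith [sq_nonneg ‖(p - ycoord p • eY n) - a‖])
      rw [h2, (hdec p).2] at h3
      linarith
    rcases eq_or_lt_of_le hpK.2.2 with h3 | h3
    · have : M ≤ auxBar z0 κ R p := by
        rw [hbar, ← hκR]
        refine mul_le_mul_of_nonneg_left ?_ hκpos.le
        rw [h3]
        nlinarith [sq_nonneg ‖(p - R • eY n) - a‖]
      linarith
    · exfalso
      refine aux_no_max hn hC2 hpde hgrad z0 κ R hκpos p hpy ?_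
      refine hpmax.isLocalMax ?_
      have ho : IsOpen {z : E n | ‖(z - ycoord z • eY n) - a‖ < R ∧ δ < ycoord z ∧ ycoord z < R} :=
        (isOpen_lt hcq.norm continuous_const).inter
          ((isOpen_lt continuous_const hcy).inter (isOpen_lt hcy continuous_const))
      refine mem_of_superset (ho.mem_nhds ⟨h1, h2, h3⟩) ?_
      rintro z ⟨q1, q2, q3⟩
      exact ⟨q1.le, q2.le, q3.le⟩
  have hfin := (hpmax hz0K).trans hgp
  have hb0 : auxBar z0 κ R z0 ≤ M / R * (((n : ℝ) + 2) * ycoord z0) := by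
    have : M / R * (((n : ℝ) + 2) * ycoord z0) = κ * (((n : ℝ) + 2) * R * ycoord z0) := by
      rw [hκ]; field_simp
    rw [this]
    unfold auxBar
    refine mul_le_mul_of_nonneg_left ?_ hκpos.le
    simp
    positivity
  have hfin' : Real.log (ycoord z0) - v z0 - auxBar z0 κ R z0 ≤ ε := hfin
  linarith

/-- Liouville-type theorem for the Fefferman–Graham compactification:
if `-Δ₊v - n = 0`, `w = 1 - e^v/y ∈ H̃^{1,0}`, `w` vanishes on the boundary, and
`y|∇v| ≤ 1` (nonnegative scalar curvature of `g* = e^{2v}y^{-2}|dz|²`), then `e^v = y`. -/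
theorem liouville_fefferman_graham
    (n : ℕ) (hn : 2 ≤ n) (v : E n → ℝ)
    (hC2 : ContDiffOn ℝ 2 v (upperHalf n))
    (hpde : ∀ z ∈ upperHalf n,
      (ycoord z) ^ 2 * lap v z - ((n : ℝ) - 1) * ycoord z * partialY v z + (n : ℝ) = 0)
    (w : E n → ℝ) (hw : ∀ z ∈ upperHalf n, w z = 1 - Real.exp (v z) / ycoord z)
    (hmem : memH1T n 0 w)
    (hlim : ∀ x : EuclideanSpace ℝ (Fin n),
      Tendsto (fun y => w (pt x y)) (nhdsWithin 0 (Set.Ioi 0)) (nhds 0))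
    (hgrad : ∀ z ∈ upperHalf n, ycoord z * ‖gradient v z‖ ≤ 1) :
    ∀ z ∈ upperHalf n, Real.exp (v z) = ycoord z := by
  have hf0 : ∀ b : E n, ycoord b = 0 →
      Tendsto (fun s : ℝ => Real.log s - v (b + s • eY n)) (𝓝[>] 0) (𝓝 0) := by
    intro b hb
    have h1 := hlim (WithLp.toLp 2 (fun i : Fin n => b i.castSucc))
    have h2 : Tendsto (fun y => - Real.log (1 - w (pt (WithLp.toLp 2
        (fun i : Fin n => b i.castSucc)) y))) (𝓝[>] 0) (𝓝 0) := by
      have h3 := (((tendsto_const_nhds (x := (1 : ℝ))).sub h1).log (by norm_num)).neg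
      simpa using h3
    refine h2.congr' ?_
    filter_upwards [self_mem_nhdsWithin] with s hs
    have hs' : (0 : ℝ) < s := hs
    have hy : ycoord (b + s • eY n) = s := by
      rw [aux_ycoord_add, aux_ycoord_eY, hb]; ring
    rw [← aux_pt b hb, hw _ (by change 0 < ycoord _; rw [hy]; exact hs'), hy, sub_sub_cancel,
      Real.log_div (Real.exp_pos _).ne' hs'.ne', Real.log_exp]
    ring
  have hdec : ∀ z : E n, ycoord (z - ycoord z • eY n) = 0 ∧
      z - ycoord z • eY n + ycoord z • eY n = z := by
    intro z
    refine ⟨?_, by abel⟩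
    rw [sub_eq_add_neg, ← neg_smul, aux_ycoord_add, aux_ycoord_eY]; ring
  have hnonneg : ∀ z ∈ upperHalf n, 0 ≤ Real.log (ycoord z) - v z := by
    intro z hz
    obtain ⟨hb, hbz⟩ := hdec z
    have hz' : 0 < ycoord z := hz
    refine le_of_tendsto (hf0 _ hb) ?_
    filter_upwards [Ioo_mem_nhdsGT hz'] with s hs
    have := (aux_mono hC2 hgrad _ hb).1 (mem_Ioi.2 hs.1) (mem_Ioi.2 hz') hs.2.le
    simpa only [hbz] using this
  intro z0 hz0
  have hy0 : 0 < ycoord z0 := hz0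
  set C : ℝ := 1 + |v z0| + |Real.log (ycoord z0)| with hC
  have hCpos : 0 < C := by positivity
  have main : ∀ R : ℝ, 1 ≤ R → ycoord z0 ≤ R → ∀ ε > 0,
      Real.log (ycoord z0) - v z0
        ≤ (2 * Real.log R + C) / R * (((n : ℝ) + 2) * ycoord z0) + ε :=
    fun R hR1 hR ε hε => aux_main hn hC2 hpde hgrad hf0 hdec z0 hz0 R hR1 hR ε hε
  have hle : Real.log (ycoord z0) - v z0 ≤ 0 := by
    have hlimR : Tendsto (fun R : ℝ => (2 * Real.log R + C) / R * (((n : ℝ) + 2) * ycoord z0))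
        atTop (𝓝 0) := by
      have h1 : Tendsto (fun R : ℝ => Real.log R / R) atTop (𝓝 0) :=
        Real.isLittleO_log_id_atTop.tendsto_div_nhds_zero
      have h2 : Tendsto (fun R : ℝ => C / R) atTop (𝓝 0) := tendsto_const_nhds.div_atTop tendsto_id
      have h3 := ((h1.const_mul 2).add h2).mul_const (((n : ℝ) + 2) * ycoord z0)
      simp only [mul_zero, zero_add, zero_mul] at h3
      refine h3.congr (fun R => ?_)
      ring
    refine ge_of_tendsto hlimR ?_
    filter_upwards [eventually_ge_atTop 1, eventually_ge_atTop (ycoord z0)] with R h1 h2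
    exact le_of_forall_pos_le_add (fun ε hε => main R h1 h2 ε hε)
  have hge := hnonneg z0 hz0
  have : v z0 = Real.log (ycoord z0) := by linarith
  rw [this, Real.exp_log hy0]

end
end
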